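/- arXiv:1803.00241 — 2 statements merged into one kernel-verified Lean document; each statement's English description precedes it below -/
import Mathlib

section
/- Let $a \in \mathbb{R}$, $0 < s < 1$, $1 \le p < \infty$ and $n \ge 2$. Let $f : \partial B \to \mathbb{R}$ be measurable and suppose that $\int_B |U_a f(X)|^p\, dX < \infty$ and $\int_B \int_B \frac{|U_a f(X) - U_a f(Y)|^p}{|X-Y|^{n+sp}}\, dX\, dY < \infty$. Then $\int_{\partial B} |f|^p\, d\sigma < \infty$ and $\int_{\partial B}\int_{\partial B} \frac{|f(x)-f(y)|^p}{|x-y|^{n-1+sp}}\, d\sigma(x)\, d\sigma(y) < \infty$. -/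
open MeasureTheory Metric
open scoped NNReal ENNReal

theorem hausdorffMeasure_le_of_expanding {X Y : Type*} [MetricSpace X] [MeasurableSpace X]
    [BorelSpace X] [MetricSpace Y] [MeasurableSpace Y] [BorelSpace Y] (g : X → Y) (K : ℝ≥0)
    {A : Set X} (h : ∀ x ∈ A, ∀ y ∈ A, dist x y ≤ K * dist (g x) (g y)) {d : ℝ} (hd : 0 ≤ d) :
    μH[d] A ≤ (K : ℝ≥0∞) ^ d * μH[d] (g '' A) := by
  have hanti : AntilipschitzWith K (A.domRestrict g) :=
    AntilipschitzWith.of_le_mul_dist fun x y => h x x.2 y y.2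
  have h1 := hanti.le_hausdorffMeasure_image hd Set.univ
  have h2 : μH[d] (Subtype.val '' (Set.univ : Set A)) = μH[d] (Set.univ : Set A) :=
    isometry_subtype_coe.hausdorffMeasure_image (Or.inl hd) Set.univ
  rw [Set.image_univ, Subtype.range_coe] at h2
  rw [Set.image_univ, Set.range_domRestrict, ← h2] at h1
  exact h1

theorem dist_normalize_le {E : Type*} [NormedAddCommGroup E] [NormedSpace ℝ E] {x y : E}
    (hx : 1 / 2 ≤ ‖x‖) (hy : 1 / 2 ≤ ‖y‖) :
    dist (‖x‖⁻¹ • x) (‖y‖⁻¹ • y) ≤ 4 * dist x y := by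
  have hx0 : 0 < ‖x‖ := by linarith
  have hy0 : 0 < ‖y‖ := by linarith
  have e : ‖x‖⁻¹ • x - ‖y‖⁻¹ • y = ‖x‖⁻¹ • ((x - y) + (‖y‖ - ‖x‖) • (‖y‖⁻¹ • y)) := by
    rw [smul_add, smul_smul, smul_sub, smul_smul]
    have : ‖x‖⁻¹ * (‖y‖ - ‖x‖) * ‖y‖⁻¹ = ‖x‖⁻¹ - ‖y‖⁻¹ := by field_simp
    rw [this, sub_smul]; abel
  rw [dist_eq_norm, dist_eq_norm, e, norm_smul, norm_inv, norm_norm]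
  have h1 : ‖(‖y‖ - ‖x‖) • (‖y‖⁻¹ • y)‖ ≤ ‖x - y‖ := by
    rw [norm_smul, norm_smul, norm_inv, norm_norm, inv_mul_cancel₀ hy0.ne', mul_one,
      Real.norm_eq_abs, abs_sub_comm]
    exact abs_norm_sub_norm_le x y
  have h2 : ‖x‖⁻¹ ≤ 2 := by
    rw [inv_le_comm₀ hx0 two_pos]; linarith
  calc _ ≤ 2 * (‖x - y‖ + ‖x - y‖) := by
        gcongr
        exact (norm_add_le _ _).trans (by gcongr)
    _ = _ := by ring

theorem dist_le_of_mem_sphere_cap {m : ℕ} (i : Fin (m + 1)) {ε κ : ℝ} (hε : |ε| = 1) (hκ : 0 < κ)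
    {x y : EuclideanSpace ℝ (Fin (m + 1))} (hx : ‖x‖ = 1) (hy : ‖y‖ = 1)
    (hxi : κ ≤ ε * x i) (hyi : κ ≤ ε * y i) :
    dist x y ≤ Real.sqrt (m + 1) * (1 + m / κ) *
      dist (fun j => x (i.succAbove j)) (fun j => y (i.succAbove j)) := by
  set δ := dist (fun j => x (i.succAbove j)) (fun j => y (i.succAbove j)) with hδ
  have hδ0 : 0 ≤ δ := dist_nonneg
  have hj : ∀ j, |x (i.succAbove j) - y (i.succAbove j)| ≤ δ := fun j => by
    rw [← Real.dist_eq]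
    exact dist_le_pi_dist (fun j => x (i.succAbove j)) (fun j => y (i.succAbove j)) j
  have hb : ∀ z : EuclideanSpace ℝ (Fin (m + 1)), ‖z‖ = 1 → ∀ j, |z j| ≤ 1 := fun z hz j => by
    have := PiLp.norm_apply_le z j
    rwa [hz] at this
  have hsum : ∀ z : EuclideanSpace ℝ (Fin (m + 1)), ‖z‖ = 1 →
      z i ^ 2 + ∑ j, z (i.succAbove j) ^ 2 = 1 := fun z hz => by
    rw [← Fin.sum_univ_succAbove (fun j => z j ^ 2) i, ← EuclideanSpace.real_norm_sq_eq, hz]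
    norm_num
  have hsq : |x i ^ 2 - y i ^ 2| ≤ 2 * m * δ := by
    have : x i ^ 2 - y i ^ 2 = ∑ j, (y (i.succAbove j) ^ 2 - x (i.succAbove j) ^ 2) := by
      rw [Finset.sum_sub_distrib]; linarith [hsum x hx, hsum y hy]
    rw [this]
    refine (Finset.abs_sum_le_sum_abs _ _).trans ?_
    calc _ ≤ ∑ j : Fin m, 2 * δ := by
          refine Finset.sum_le_sum fun j _ => ?_
          rw [sq_sub_sq, abs_mul, abs_sub_comm]
          gcongr
          · exact (abs_add_le _ _).trans
              (by linarith [hb x hx (i.succAbove j), hb y hy (i.succAbove j)])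
          · exact hj j
      _ = _ := by simp; ring
  have hi : |x i - y i| ≤ m / κ * δ := by
    have h1 : 2 * κ * |x i - y i| ≤ |x i ^ 2 - y i ^ 2| := by
      rw [sq_sub_sq, abs_mul]
      gcongr
      have : |x i + y i| = |ε * (x i + y i)| := by rw [abs_mul, hε, one_mul]
      rw [this]
      exact le_trans (by linarith) (le_abs_self _)
    rw [div_mul_eq_mul_div, le_div_iff₀ hκ]
    linarith
  have hall : dist x.ofLp y.ofLp ≤ (1 + m / κ) * δ := by
    refine (dist_pi_le_iff (by positivity)).2 ?_
    rw [i.forall_iff_succAbove]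
    have : 0 ≤ m / κ * δ := by positivity
    refine ⟨?_, fun j => ?_⟩
    · rw [Real.dist_eq]; linarith
    · rw [Real.dist_eq]; linarith [hj j]
  have hanti := (PiLp.antilipschitzWith_ofLp 2 (fun _ : Fin (m + 1) => ℝ)).le_mul_dist x y
  refine hanti.trans ?_
  rw [mul_assoc]
  have : (((Fintype.card (Fin (m + 1)) : ℝ≥0) ^ (1 / (2 : ℝ≥0∞)).toReal : ℝ≥0) : ℝ) =
      Real.sqrt (m + 1) := by
    rw [Real.sqrt_eq_rpow]; simp
  rw [this]
  gcongr

theorem exists_hausdorffMeasure_eq_smul_volume {E : Type*} [NormedAddCommGroup E]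
    [InnerProductSpace ℝ E] [FiniteDimensional ℝ E] [MeasurableSpace E] [BorelSpace E] {d : ℕ}
    (hd : Module.finrank ℝ E = d) :
    ∃ c : ℝ≥0, (μH[(d : ℝ)] : Measure E) = c • volume := by
  subst hd
  exact ⟨_, Measure.isAddLeftInvariant_eq_smul _ _⟩

open scoped Pointwise in
theorem hausdorffMeasure_le_volume_cone_of_subset_cap {m : ℕ} (i : Fin (m + 1)) {ε κ : ℝ}
    (hε : |ε| = 1) (hκ : 0 < κ) :
    ∃ C : ℝ≥0∞, C ≠ ⊤ ∧ ∀ A : Set (EuclideanSpace ℝ (Fin (m + 1))),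
      (∀ x ∈ A, ‖x‖ = 1 ∧ κ ≤ ε * x i) →
        μH[(m : ℝ)] A ≤ C * volume (Set.Ioo (0 : ℝ) 1 • A) := by
  set K : ℝ≥0 := ⟨Real.sqrt (m + 1) * (1 + m / κ), by positivity⟩ with hK
  obtain ⟨c, hc⟩ : ∃ c : ℝ≥0,
      (μH[((m + 1 : ℕ) : ℝ)] : Measure (EuclideanSpace ℝ (Fin (m + 1)))) = c • volume :=
    exists_hausdorffMeasure_eq_smul_volume (by simp)
  refine ⟨(K : ℝ≥0∞) ^ (m : ℝ) * (2 * ((4 : ℝ≥0) ^ ((m + 1 : ℕ) : ℝ) * c)), ?_, fun A hA => ?_⟩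
  · exact ENNReal.mul_ne_top (by simp) (ENNReal.mul_ne_top (by simp)
      (ENNReal.mul_ne_top (by simp) (by simp)))
  set proj : EuclideanSpace ℝ (Fin (m + 1)) → (Fin m → ℝ) := fun x j => x (i.succAbove j) with hproj
  have h1 : μH[(m : ℝ)] A ≤ (K : ℝ≥0∞) ^ (m : ℝ) * volume (proj '' A) := by
    refine (hausdorffMeasure_le_of_expanding proj K (fun x hx y hy => ?_) (by positivity)).trans ?_
    · exact dist_le_of_mem_sphere_cap i hε hκ (hA x hx).1 (hA y hy).1 (hA x hx).2 (hA y hy).2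
    · rw [← hausdorffMeasure_pi_real, Fintype.card_fin]
  set T : Set (EuclideanSpace ℝ (Fin (m + 1))) :=
    {X | ∃ r ∈ Set.Ioo (1 / 2 : ℝ) 1, ∃ x ∈ A, X = r • x} with hT
  have hTsub : T ⊆ Set.Ioo (0 : ℝ) 1 • A := by
    rintro X ⟨r, hr, x, hx, rfl⟩
    exact Set.smul_mem_smul ⟨by linarith [hr.1], hr.2⟩ hx
  have hnorm : ∀ r ∈ Set.Ioo (1 / 2 : ℝ) 1, ∀ x ∈ A, ‖r • x‖ = r := fun r hr x hx => by
    rw [norm_smul, (hA x hx).1, mul_one, Real.norm_of_nonneg (by linarith [hr.1])]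
  set H : EuclideanSpace ℝ (Fin (m + 1)) → (Fin (m + 1) → ℝ) :=
    fun X => i.insertNth ‖X‖ (proj (‖X‖⁻¹ • X)) with hH
  have hLip : LipschitzOnWith 4 H T := by
    have hT2 : ∀ X ∈ T, 1 / 2 ≤ ‖X‖ := by
      rintro X ⟨r, hr, x, hx, rfl⟩
      rw [hnorm r hr x hx]; exact hr.1.le
    refine LipschitzOnWith.of_dist_le_mul fun X hX Y hY => ?_
    refine (dist_pi_le_iff (by positivity)).2 ?_
    rw [i.forall_iff_succAbove]
    refine ⟨?_, fun j => ?_⟩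
    · simp only [hH, Fin.insertNth_apply_same]
      refine (dist_norm_norm_le X Y).trans ?_
      rw [← dist_eq_norm]
      have : 0 ≤ dist X Y := dist_nonneg
      push_cast; linarith
    · simp only [hH, Fin.insertNth_apply_succAbove, hproj]
      refine le_trans ?_ (dist_normalize_le (hT2 X hX) (hT2 Y hY))
      rw [dist_eq_norm, dist_eq_norm]
      exact PiLp.norm_apply_le (‖X‖⁻¹ • X - ‖Y‖⁻¹ • Y) (i.succAbove j)
  have h2 : volume (H '' T) ≤ (4 : ℝ≥0) ^ ((m + 1 : ℕ) : ℝ) * (c * volume T) := by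
    have := hLip.hausdorffMeasure_image_le (d := ((m + 1 : ℕ) : ℝ)) (by positivity)
    rw [hc] at this
    rw [← hausdorffMeasure_pi_real, Fintype.card_fin]
    simpa using this
  have h3 : volume (Set.Ioo (1 / 2 : ℝ) 1 ×ˢ (proj '' A)) ≤ volume (H '' T) := by
    rw [← (volume_preserving_piFinSuccAbove (fun _ : Fin (m + 1) => ℝ) i).measure_preimage_equiv]
    refine measure_mono ?_
    rintro z ⟨hz1, x, hx, hz2⟩
    refine ⟨z i • x, ⟨z i, hz1, x, hx, rfl⟩, ?_⟩
    have hzi : z i ≠ 0 := by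
      have : (1 / 2 : ℝ) < z i := hz1.1
      linarith
    change i.insertNth ‖z i • x‖ (proj (‖z i • x‖⁻¹ • z i • x)) = z
    rw [hnorm (z i) hz1 x hx, smul_smul, inv_mul_cancel₀ hzi, one_smul, hz2]
    exact Fin.insertNth_self_removeNth i z
  rw [Measure.volume_eq_prod, Measure.prod_prod, Real.volume_Ioo] at h3
  have h4 : volume (proj '' A) ≤ 2 * volume (H '' T) := by
    have e : (2 : ℝ≥0∞) * ENNReal.ofReal (1 - 1 / 2) = 1 := by
      rw [← ENNReal.ofReal_ofNat 2, ← ENNReal.ofReal_mul (by norm_num)]; norm_num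
    calc _ = 2 * (ENNReal.ofReal (1 - 1 / 2) * volume (proj '' A)) := by
          rw [← mul_assoc, e, one_mul]
      _ ≤ _ := by gcongr
  calc _ ≤ _ := h1
    _ ≤ (K : ℝ≥0∞) ^ (m : ℝ) * (2 * ((4 : ℝ≥0) ^ ((m + 1 : ℕ) : ℝ) * (c * volume T))) := by
        gcongr; exact h4.trans (by gcongr)
    _ ≤ (K : ℝ≥0∞) ^ (m : ℝ) * (2 * ((4 : ℝ≥0) ^ ((m + 1 : ℕ) : ℝ) *
          (c * volume (Set.Ioo (0 : ℝ) 1 • A)))) := by gcongr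
    _ = _ := by ring

open scoped Pointwise in
theorem hausdorffMeasure_restrict_sphere_le_toSphere (m : ℕ) :
    ∃ C : ℝ≥0∞, C ≠ ⊤ ∧
      (μH[(m : ℝ)] : Measure (EuclideanSpace ℝ (Fin (m + 1)))).restrict (sphere 0 1) ≤
        C • (volume : Measure (EuclideanSpace ℝ (Fin (m + 1)))).toSphere.map Subtype.val := by
  set κ : ℝ := ((m : ℝ) + 1)⁻¹ with hκ
  have hκ0 : 0 < κ := by positivity
  choose C hC hCA using fun (i : Fin (m + 1)) (ε : ℤˣ) =>
    hausdorffMeasure_le_volume_cone_of_subset_cap (ε := ((ε : ℤ) : ℝ)) i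
      (by rcases Int.units_eq_one_or ε with h | h <;> simp [h]) hκ0
  refine ⟨∑ i, ∑ ε, C i ε, by simp [hC], ?_⟩
  refine Measure.le_iff.2 fun s hs => ?_
  rw [Measure.restrict_apply hs, Measure.smul_apply, Measure.map_apply measurable_subtype_coe hs,
    Measure.toSphere_apply' _ (measurable_subtype_coe hs), smul_eq_mul,
    Subtype.image_preimage_coe, Set.inter_comm]
  set A : Set (EuclideanSpace ℝ (Fin (m + 1))) := sphere 0 1 ∩ s with hA
  set P : Fin (m + 1) → ℤˣ → Set (EuclideanSpace ℝ (Fin (m + 1))) :=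
    fun i ε => {x ∈ A | κ ≤ ((ε : ℤ) : ℝ) * x i} with hP
  have hcover : A ⊆ ⋃ i, ⋃ ε, P i ε := by
    intro x hx
    have hx1 : ‖x‖ = 1 := by simpa using hx.1
    obtain ⟨i, hi⟩ : ∃ i, κ ≤ |x i| := by
      by_contra! hcon
      have h1 : ∑ i, x i ^ 2 < ∑ i : Fin (m + 1), κ := by
        refine Finset.sum_lt_sum_of_nonempty Finset.univ_nonempty fun i _ => ?_
        have h2 : |x i| ≤ 1 := hx1 ▸ PiLp.norm_apply_le x i
        calc x i ^ 2 = |x i| * |x i| := by rw [← sq, sq_abs]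
          _ ≤ |x i| * 1 := by gcongr
          _ < κ := by rw [mul_one]; exact hcon i
      rw [← EuclideanSpace.real_norm_sq_eq, hx1] at h1
      have h3 : ((m : ℝ) + 1) * κ = 1 := mul_inv_cancel₀ (by positivity)
      simp [h3] at h1
    simp only [Set.mem_iUnion]
    rcases le_total 0 (x i) with h | h
    · exact ⟨i, 1, hx, by simpa [abs_of_nonneg h] using hi⟩
    · exact ⟨i, -1, hx, by simpa [abs_of_nonpos h] using hi⟩
  have hone : (1 : ℝ≥0∞) ≤ Module.finrank ℝ (EuclideanSpace ℝ (Fin (m + 1))) := by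
    rw [finrank_euclideanSpace_fin]; simp
  calc μH[(m : ℝ)] A ≤ μH[(m : ℝ)] (⋃ i, ⋃ ε, P i ε) := measure_mono hcover
    _ ≤ ∑ i, ∑ ε, μH[(m : ℝ)] (P i ε) :=
        (measure_iUnion_fintype_le _ _).trans
          (Finset.sum_le_sum fun i _ => measure_iUnion_fintype_le _ _)
    _ ≤ ∑ i, ∑ ε, C i ε * volume (Set.Ioo (0 : ℝ) 1 • A) := by
        refine Finset.sum_le_sum fun i _ => Finset.sum_le_sum fun ε _ => ?_
        refine (hCA i ε _ fun x hx => ⟨by simpa using hx.1.1, hx.2⟩).trans ?_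
        gcongr
        exact Set.sep_subset _ _
    _ = (∑ i, ∑ ε, C i ε) * (1 * volume (Set.Ioo (0 : ℝ) 1 • A)) := by
        simp_rw [one_mul, Finset.sum_mul]
    _ ≤ _ := by gcongr

theorem lintegral_toSphere_lintegral_Ioi {E : Type*} [NormedAddCommGroup E] [NormedSpace ℝ E]
    [FiniteDimensional ℝ E] [Nontrivial E] [MeasurableSpace E] [BorelSpace E] (μ : Measure E)
    [μ.IsAddHaarMeasure] {F : E → ℝ≥0∞} (hF : Measurable F) :
    ∫⁻ x : sphere (0 : E) 1, ∫⁻ r in Set.Ioi (0 : ℝ),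
        ENNReal.ofReal (r ^ (Module.finrank ℝ E - 1)) * F (r • (x : E)) ∂volume ∂μ.toSphere =
      ∫⁻ X, F X ∂μ := by
  have h0 : ∫⁻ X, F X ∂μ = ∫⁻ X : ({0}ᶜ : Set E), F X ∂(μ.comap (↑)) := by
    rw [lintegral_subtype_comap (measurableSet_singleton _).compl F,
      restrict_compl_singleton]
  have hmeas : Measurable fun q : sphere (0 : E) 1 × Set.Ioi (0 : ℝ) =>
      F ((q.2 : ℝ) • (q.1 : E)) := by fun_prop
  have h1 := μ.measurePreserving_homeomorphUnitSphereProd.lintegral_comp hmeas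
  have h2 : ∀ X : ({0}ᶜ : Set E), ((homeomorphUnitSphereProd E X).2 : ℝ) •
      ((homeomorphUnitSphereProd E X).1 : E) = X := fun X =>
    congrArg Subtype.val ((homeomorphUnitSphereProd E).symm_apply_apply X)
  simp only [h2] at h1
  rw [h0, h1, lintegral_prod _ hmeas.aemeasurable]
  refine lintegral_congr fun x => ?_
  rw [Measure.volumeIoiPow, lintegral_withDensity_eq_lintegral_mul _ (by fun_prop) (by fun_prop),
    ← lintegral_subtype_comap measurableSet_Ioi]
  rfl

theorem lintegral_toSphere_lintegral_Ioo_le {E : Type*} [NormedAddCommGroup E] [NormedSpace ℝ E]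
    [FiniteDimensional ℝ E] [Nontrivial E] [MeasurableSpace E] [BorelSpace E] (μ : Measure E)
    [μ.IsAddHaarMeasure] {F : E → ℝ≥0∞} (hF : Measurable F) :
    ∫⁻ x : sphere (0 : E) 1, ∫⁻ r in Set.Ioo (1 / 2 : ℝ) 1, F (r • (x : E)) ∂volume ∂μ.toSphere ≤
      2 ^ (Module.finrank ℝ E - 1) * ∫⁻ X in ball (0 : E) 1, F X ∂μ := by
  set k := Module.finrank ℝ E - 1
  rw [← lintegral_indicator measurableSet_ball,
    ← lintegral_toSphere_lintegral_Ioi μ (hF.indicator measurableSet_ball),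
    ← lintegral_const_mul' _ _ (by simp)]
  refine lintegral_mono fun x => ?_
  rw [← lintegral_const_mul' _ _ (by simp)]
  have hsub : Set.Ioo (1 / 2 : ℝ) 1 ⊆ Set.Ioi 0 := fun r hr => by
    have := hr.1
    simp only [Set.mem_Ioi]; linarith
  refine (setLIntegral_mono' measurableSet_Ioo fun r hr => ?_).trans (lintegral_mono_set hsub)
  have hr0 : 0 < r := hsub hr
  have hmem : r • (x : E) ∈ ball (0 : E) 1 := by
    simpa [norm_smul, abs_of_pos hr0] using hr.2
  rw [Set.indicator_of_mem hmem, ← mul_assoc]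
  refine le_mul_of_one_le_left zero_le ?_
  rw [← ENNReal.ofReal_ofNat 2, ← ENNReal.ofReal_pow (by norm_num),
    ← ENNReal.ofReal_mul (by positivity), ← mul_pow, ENNReal.one_le_ofReal]
  exact one_le_pow₀ (by linarith [hr.1])

theorem lintegral_toSphere_prod_le {E : Type*} [NormedAddCommGroup E] [NormedSpace ℝ E]
    [FiniteDimensional ℝ E] [Nontrivial E] [MeasurableSpace E] [BorelSpace E] (μ : Measure E)
    [μ.IsAddHaarMeasure] {G : E → E → ℝ≥0∞} (hG : Measurable (Function.uncurry G)) :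
    ∫⁻ x : sphere (0 : E) 1, ∫⁻ y : sphere (0 : E) 1, ∫⁻ r in Set.Ioo (1 / 2 : ℝ) 1,
        ∫⁻ ρ in Set.Ioo (1 / 2 : ℝ) 1, G (r • (x : E)) (ρ • (y : E)) ∂volume ∂volume
          ∂μ.toSphere ∂μ.toSphere ≤
      2 ^ (Module.finrank ℝ E - 1) * (2 ^ (Module.finrank ℝ E - 1) *
        ∫⁻ X in ball (0 : E) 1, ∫⁻ Y in ball (0 : E) 1, G X Y ∂μ ∂μ) := by
  set k := Module.finrank ℝ E - 1
  calc _ = ∫⁻ x : sphere (0 : E) 1, ∫⁻ r in Set.Ioo (1 / 2 : ℝ) 1, ∫⁻ y : sphere (0 : E) 1,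
        ∫⁻ ρ in Set.Ioo (1 / 2 : ℝ) 1, G (r • (x : E)) (ρ • (y : E)) ∂volume
          ∂μ.toSphere ∂volume ∂μ.toSphere := by
        refine lintegral_congr fun x => lintegral_lintegral_swap (Measurable.aemeasurable ?_)
        refine Measurable.lintegral_prod_right' (f := fun q : (sphere (0 : E) 1 × ℝ) × ℝ =>
          G (q.1.2 • (x : E)) (q.2 • (q.1.1 : E))) ?_
        exact hG.comp (by fun_prop : Measurable fun q : (sphere (0 : E) 1 × ℝ) × ℝ =>
          (q.1.2 • (x : E), q.2 • (q.1.1 : E)))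
    _ ≤ ∫⁻ x : sphere (0 : E) 1, ∫⁻ r in Set.Ioo (1 / 2 : ℝ) 1,
        2 ^ k * ∫⁻ Y in ball (0 : E) 1, G (r • (x : E)) Y ∂μ ∂volume ∂μ.toSphere :=
        lintegral_mono fun x => lintegral_mono fun r =>
          lintegral_toSphere_lintegral_Ioo_le μ hG.of_uncurry_left
    _ ≤ 2 ^ k * ∫⁻ X in ball (0 : E) 1, 2 ^ k * ∫⁻ Y in ball (0 : E) 1, G X Y ∂μ ∂μ :=
        lintegral_toSphere_lintegral_Ioo_le μ
          (F := fun X => 2 ^ k * ∫⁻ Y in ball (0 : E) 1, G X Y ∂μ)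
          (hG.lintegral_prod_right'.const_mul _)
    _ = _ := by rw [lintegral_const_mul' _ _ (by simp)]

theorem half_rpow_abs_le_rpow {r : ℝ} (a : ℝ) (hr : r ∈ Set.Ioo (1 / 2 : ℝ) 1) :
    (1 / 2 : ℝ) ^ |a| ≤ r ^ a := by
  have hr0 : 0 < r := by linarith [hr.1]
  calc (1 / 2 : ℝ) ^ |a| ≤ r ^ |a| := Real.rpow_le_rpow (by norm_num) hr.1.le (abs_nonneg a)
    _ ≤ r ^ a := Real.rpow_le_rpow_of_exponent_ge hr0 hr.2.le (le_abs_self a)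

theorem norm_smul_sub_smul_le {E : Type*} [NormedAddCommGroup E] [NormedSpace ℝ E] {x y : E}
    (hy : ‖y‖ = 1) {r ρ : ℝ} (hr : |r| ≤ 1) :
    ‖r • x - ρ • y‖ ≤ ‖x - y‖ + |r - ρ| := by
  have e : r • x - ρ • y = r • (x - y) + (r - ρ) • y := by
    rw [smul_sub, sub_smul]; abel
  rw [e]
  refine (norm_add_le _ _).trans ?_
  rw [norm_smul, norm_smul, hy, mul_one, Real.norm_eq_abs, Real.norm_eq_abs]
  gcongr
  exact mul_le_of_le_one_left (norm_nonneg _) hr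

theorem abs_sub_rpow_div_le {E : Type*} [NormedAddCommGroup E] [NormedSpace ℝ E] {x y : E}
    (hx : ‖x‖ = 1) (hy : ‖y‖ = 1) (hxy : x ≠ y) (a u v : ℝ) {p q : ℝ} (hp : 1 ≤ p) (hq : 0 ≤ q)
    {r ρ : ℝ} (hr : r ∈ Set.Ioo (1 / 2 : ℝ) 1) (hρ : ρ ∈ Set.Ioo (1 / 2 : ℝ) 1)
    (hrρ : |r - ρ| ≤ ‖x - y‖) :
    |u - v| ^ p / ‖x - y‖ ^ q ≤
      2 ^ (p - 1) * 2 ^ q / (2 * (1 / 2) ^ |a|) ^ p *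
        (|r ^ a * u - ρ ^ a * v| ^ p / ‖r • x - ρ • y‖ ^ q +
          |ρ ^ a * u - r ^ a * v| ^ p / ‖ρ • x - r • y‖ ^ q) := by
  set c : ℝ := (1 / 2) ^ |a| with hc
  have hc0 : 0 < c := by positivity
  set d := ‖x - y‖ with hd
  have hd0 : 0 < d := norm_pos_iff.2 (sub_ne_zero.2 hxy)
  have key : ∀ r ρ : ℝ, r ∈ Set.Ioo (1 / 2 : ℝ) 1 → ρ ∈ Set.Ioo (1 / 2 : ℝ) 1 →
      |r - ρ| ≤ d → ∀ t : ℝ, 0 ≤ t → t / (2 * d) ^ q ≤ t / ‖r • x - ρ • y‖ ^ q := by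
    intro r ρ hr hρ hrρ t ht
    have hr0 : 0 < r := by linarith [hr.1]
    have hρ0 : 0 < ρ := by linarith [hρ.1]
    have hpos : 0 < ‖r • x - ρ • y‖ := by
      rw [norm_pos_iff, sub_ne_zero]
      intro h
      have h2 := congrArg norm h
      rw [norm_smul, norm_smul, hx, hy, mul_one, mul_one, Real.norm_of_nonneg hr0.le,
        Real.norm_of_nonneg hρ0.le] at h2
      subst h2
      exact hxy (smul_right_injective E hr0.ne' h)
    gcongr
    refine (norm_smul_sub_smul_le hy (by rw [abs_of_pos hr0]; exact hr.2.le)).trans ?_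
    linarith
  set P := |r ^ a * u - ρ ^ a * v| with hP
  set Q := |ρ ^ a * u - r ^ a * v| with hQ
  have h1 : 2 * c * |u - v| ≤ P + Q := by
    calc 2 * c * |u - v| ≤ (r ^ a + ρ ^ a) * |u - v| := by
          gcongr
          linarith [half_rpow_abs_le_rpow a hr, half_rpow_abs_le_rpow a hρ]
      _ = |(r ^ a + ρ ^ a) * (u - v)| := by
          rw [abs_mul, abs_of_pos (a := r ^ a + ρ ^ a)]
          linarith [half_rpow_abs_le_rpow a hr, half_rpow_abs_le_rpow a hρ]
      _ = |(r ^ a * u - ρ ^ a * v) + (ρ ^ a * u - r ^ a * v)| := by ring_nf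
      _ ≤ P + Q := abs_add_le _ _
  have h2 : (2 * c) ^ p * |u - v| ^ p ≤ 2 ^ (p - 1) * (P ^ p + Q ^ p) := by
    rw [← Real.mul_rpow (by positivity) (abs_nonneg _)]
    refine (Real.rpow_le_rpow (by positivity) h1 (by linarith)).trans ?_
    have := NNReal.rpow_add_le_mul_rpow_add_rpow ⟨P, abs_nonneg _⟩ ⟨Q, abs_nonneg _⟩ hp
    exact_mod_cast this
  calc |u - v| ^ p / d ^ q = 2 ^ q / (2 * c) ^ p * ((2 * c) ^ p * |u - v| ^ p) / (2 * d) ^ q := by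
        rw [Real.mul_rpow (by norm_num : (0 : ℝ) ≤ 2) hd0.le]
        field_simp
    _ ≤ 2 ^ q / (2 * c) ^ p * (2 ^ (p - 1) * (P ^ p + Q ^ p)) / (2 * d) ^ q := by gcongr
    _ = 2 ^ (p - 1) * 2 ^ q / (2 * c) ^ p * (P ^ p / (2 * d) ^ q + Q ^ p / (2 * d) ^ q) := by ring
    _ ≤ _ := by
        refine mul_le_mul_of_nonneg_left (add_le_add ?_ ?_) (by positivity)
        · exact key r ρ hr hρ hrρ _ (Real.rpow_nonneg (abs_nonneg _) _)
        · exact key ρ r hρ hr (by rwa [abs_sub_comm]) _ (Real.rpow_nonneg (abs_nonneg _) _)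

theorem ofReal_div_eight_le_volume {r d : ℝ} (hr : r ∈ Set.Ioo (1 / 2 : ℝ) 1) (hd : d ≤ 2) :
    ENNReal.ofReal (d / 8) ≤ volume ({ρ | |r - ρ| ≤ d} ∩ Set.Ioo (1 / 2 : ℝ) 1) := by
  obtain ⟨h1, h2⟩ := hr
  rcases le_total r (3 / 4) with h | h
  · calc ENNReal.ofReal (d / 8) = volume (Set.Ioo r (r + d / 8)) := by
          rw [Real.volume_Ioo]; congr 1; ring
      _ ≤ _ := measure_mono fun ρ hρ => by
          obtain ⟨h3, h4⟩ := hρ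
          have h5 : |r - ρ| ≤ d := abs_le.2 ⟨by linarith, by linarith⟩
          exact ⟨h5, by linarith, by linarith⟩
  · calc ENNReal.ofReal (d / 8) = volume (Set.Ioo (r - d / 8) r) := by
          rw [Real.volume_Ioo]; congr 1; ring
      _ ≤ _ := measure_mono fun ρ hρ => by
          obtain ⟨h3, h4⟩ := hρ
          have h5 : |r - ρ| ≤ d := abs_le.2 ⟨by linarith, by linarith⟩
          exact ⟨h5, by linarith, by linarith⟩

theorem ofReal_abs_sub_rpow_div_le_lintegral {E : Type*} [NormedAddCommGroup E] [NormedSpace ℝ E]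
    {x y : E} (hx : ‖x‖ = 1) (hy : ‖y‖ = 1) (a : ℝ) {u v : ℝ} (huv : x = y → u = v) {p q : ℝ}
    (hp : 1 ≤ p) (hq : 0 ≤ q) :
    ENNReal.ofReal (|u - v| ^ p / ‖x - y‖ ^ q) ≤
      ENNReal.ofReal (16 * (2 ^ (p - 1) * 2 ^ (q + 1) / (2 * (1 / 2) ^ |a|) ^ p)) *
        ∫⁻ r in Set.Ioo (1 / 2 : ℝ) 1, ∫⁻ ρ in Set.Ioo (1 / 2 : ℝ) 1,
          (ENNReal.ofReal (|r ^ a * u - ρ ^ a * v| ^ p / ‖r • x - ρ • y‖ ^ (q + 1)) +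
            ENNReal.ofReal (|ρ ^ a * u - r ^ a * v| ^ p / ‖ρ • x - r • y‖ ^ (q + 1))) := by
  rcases eq_or_ne x y with hxy | hxy
  · rw [huv hxy, sub_self, abs_zero, Real.zero_rpow (by linarith)]; simp
  set K : ℝ := 2 ^ (p - 1) * 2 ^ (q + 1) / (2 * (1 / 2) ^ |a|) ^ p with hK
  have hK0 : 0 < K := by positivity
  set d := ‖x - y‖ with hd
  have hd0 : 0 < d := norm_pos_iff.2 (sub_ne_zero.2 hxy)
  have hd2 : d ≤ 2 := (norm_sub_le x y).trans (by rw [hx, hy]; norm_num)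
  set t : ℝ := |u - v| ^ p / d ^ (q + 1) / K with ht
  have ht0 : 0 ≤ t := by positivity
  have hinner : ∀ r ∈ Set.Ioo (1 / 2 : ℝ) 1, ENNReal.ofReal (t * (d / 8)) ≤
      ∫⁻ ρ in Set.Ioo (1 / 2 : ℝ) 1,
        (ENNReal.ofReal (|r ^ a * u - ρ ^ a * v| ^ p / ‖r • x - ρ • y‖ ^ (q + 1)) +
          ENNReal.ofReal (|ρ ^ a * u - r ^ a * v| ^ p / ‖ρ • x - r • y‖ ^ (q + 1))) := by
    intro r hr
    have hmeas : MeasurableSet {ρ : ℝ | |r - ρ| ≤ d} :=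
      measurableSet_le (by fun_prop) measurable_const
    calc ENNReal.ofReal (t * (d / 8)) = ENNReal.ofReal t * ENNReal.ofReal (d / 8) :=
          ENNReal.ofReal_mul ht0
      _ ≤ ENNReal.ofReal t * volume ({ρ : ℝ | |r - ρ| ≤ d} ∩ Set.Ioo (1 / 2 : ℝ) 1) := by
          gcongr
          exact ofReal_div_eight_le_volume hr hd2
      _ = ∫⁻ _ in {ρ : ℝ | |r - ρ| ≤ d} ∩ Set.Ioo (1 / 2 : ℝ) 1, ENNReal.ofReal t :=
          (setLIntegral_const _ _).symm
      _ ≤ ∫⁻ ρ in {ρ : ℝ | |r - ρ| ≤ d} ∩ Set.Ioo (1 / 2 : ℝ) 1,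
          (ENNReal.ofReal (|r ^ a * u - ρ ^ a * v| ^ p / ‖r • x - ρ • y‖ ^ (q + 1)) +
            ENNReal.ofReal (|ρ ^ a * u - r ^ a * v| ^ p / ‖ρ • x - r • y‖ ^ (q + 1))) := by
          refine setLIntegral_mono' (hmeas.inter measurableSet_Ioo) fun ρ hρ => ?_
          rw [← ENNReal.ofReal_add (by positivity) (by positivity)]
          refine ENNReal.ofReal_le_ofReal ?_
          rw [ht, div_le_iff₀' hK0]
          exact abs_sub_rpow_div_le hx hy hxy a u v hp (by linarith) hr hρ.2 hρ.1
      _ ≤ _ := lintegral_mono_set Set.inter_subset_right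
  calc ENNReal.ofReal (|u - v| ^ p / d ^ q)
      = ENNReal.ofReal (16 * K) * (ENNReal.ofReal (t * (d / 8)) * ENNReal.ofReal (1 - 1 / 2)) := by
        rw [← ENNReal.ofReal_mul (by positivity), ← ENNReal.ofReal_mul (by positivity), ht,
          Real.rpow_add hd0, Real.rpow_one]
        congr 1
        field_simp
        ring
    _ = ENNReal.ofReal (16 * K) *
        ∫⁻ _ in Set.Ioo (1 / 2 : ℝ) 1, ENNReal.ofReal (t * (d / 8)) := by
        rw [setLIntegral_const, Real.volume_Ioo]
    _ ≤ _ := by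
        gcongr ENNReal.ofReal (16 * K) * ?_
        exact setLIntegral_mono' measurableSet_Ioo hinner

theorem ofReal_abs_rpow_le_lintegral (a u : ℝ) {p : ℝ} (hp : 0 ≤ p) :
    ENNReal.ofReal (|u| ^ p) ≤ ENNReal.ofReal (2 / ((1 / 2) ^ |a|) ^ p) *
      ∫⁻ r in Set.Ioo (1 / 2 : ℝ) 1, ENNReal.ofReal (|r ^ a * u| ^ p) := by
  set c : ℝ := (1 / 2) ^ |a| with hc
  have hc0 : 0 < c := by positivity
  calc ENNReal.ofReal (|u| ^ p)
      = ENNReal.ofReal (2 / c ^ p) *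
        ∫⁻ _ in Set.Ioo (1 / 2 : ℝ) 1, ENNReal.ofReal ((c * |u|) ^ p) := by
        rw [setLIntegral_const, Real.volume_Ioo, ← ENNReal.ofReal_mul (by positivity),
          ← ENNReal.ofReal_mul (by positivity), Real.mul_rpow hc0.le (abs_nonneg _)]
        congr 1
        field_simp
        norm_num
    _ ≤ _ := by
        gcongr ENNReal.ofReal (2 / c ^ p) * ?_
        refine setLIntegral_mono' measurableSet_Ioo fun r hr => ?_
        gcongr
        rw [abs_mul]
        gcongr
        exact (half_rpow_abs_le_rpow a hr).trans (le_abs_self _)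

theorem norm_rpow_mul_comp_normalize_smul {E : Type*} [NormedAddCommGroup E] [NormedSpace ℝ E]
    (a : ℝ) (f : E → ℝ) {x : E} (hx : ‖x‖ = 1) {r : ℝ} (hr : 0 < r) :
    ‖r • x‖ ^ a * f (‖r • x‖⁻¹ • r • x) = r ^ a * f x := by
  rw [norm_smul, hx, mul_one, Real.norm_of_nonneg hr.le, smul_smul, inv_mul_cancel₀ hr.ne',
    one_smul]

section Sphere

variable {E : Type*} [NormedAddCommGroup E] [NormedSpace ℝ E] [FiniteDimensional ℝ E]
  [Nontrivial E] [MeasurableSpace E] [BorelSpace E] (μ : Measure E) [μ.IsAddHaarMeasure]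

theorem lintegral_toSphere_abs_rpow_lt_top (a : ℝ) {p : ℝ} (hp : 0 ≤ p) {f : E → ℝ}
    (hf : Measurable f)
    (h : ∫⁻ X in ball (0 : E) 1, ENNReal.ofReal (|‖X‖ ^ a * f (‖X‖⁻¹ • X)| ^ p) ∂μ < ⊤) :
    ∫⁻ x : sphere (0 : E) 1, ENNReal.ofReal (|f x| ^ p) ∂μ.toSphere < ⊤ := by
  have hF : Measurable fun X : E => ENNReal.ofReal (|‖X‖ ^ a * f (‖X‖⁻¹ • X)| ^ p) := by fun_prop
  set c := ENNReal.ofReal (2 / ((1 / 2) ^ |a|) ^ p) with hc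
  calc ∫⁻ x : sphere (0 : E) 1, ENNReal.ofReal (|f x| ^ p) ∂μ.toSphere
      ≤ ∫⁻ x : sphere (0 : E) 1, c * ∫⁻ r in Set.Ioo (1 / 2 : ℝ) 1,
        ENNReal.ofReal (|‖r • (x : E)‖ ^ a * f (‖r • (x : E)‖⁻¹ • r • (x : E))| ^ p)
          ∂volume ∂μ.toSphere := by
        refine lintegral_mono fun x => (ofReal_abs_rpow_le_lintegral a (f x) hp).trans_eq ?_
        congr 1
        refine setLIntegral_congr_fun measurableSet_Ioo fun r hr => ?_
        have hr0 : 0 < r := by linarith [hr.1]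
        simp only [norm_rpow_mul_comp_normalize_smul a f (norm_eq_of_mem_sphere x) hr0]
    _ = c * ∫⁻ x : sphere (0 : E) 1, ∫⁻ r in Set.Ioo (1 / 2 : ℝ) 1,
        ENNReal.ofReal (|‖r • (x : E)‖ ^ a * f (‖r • (x : E)‖⁻¹ • r • (x : E))| ^ p)
          ∂volume ∂μ.toSphere := lintegral_const_mul' _ _ ENNReal.ofReal_ne_top
    _ ≤ c * (2 ^ (Module.finrank ℝ E - 1) *
        ∫⁻ X in ball (0 : E) 1, ENNReal.ofReal (|‖X‖ ^ a * f (‖X‖⁻¹ • X)| ^ p) ∂μ) := by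
        gcongr
        exact lintegral_toSphere_lintegral_Ioo_le μ hF
    _ < ⊤ := ENNReal.mul_lt_top ENNReal.ofReal_lt_top (ENNReal.mul_lt_top (by simp) h)

theorem lintegral_toSphere_gagliardo_lt_top (a : ℝ) {p q : ℝ} (hp : 1 ≤ p) (hq : 0 ≤ q)
    {f : E → ℝ} (hf : Measurable f)
    (h : ∫⁻ X in ball (0 : E) 1, ∫⁻ Y in ball (0 : E) 1, ENNReal.ofReal
      (|‖X‖ ^ a * f (‖X‖⁻¹ • X) - ‖Y‖ ^ a * f (‖Y‖⁻¹ • Y)| ^ p / ‖X - Y‖ ^ (q + 1)) ∂μ ∂μ < ⊤) :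
    ∫⁻ x : sphere (0 : E) 1, ∫⁻ y : sphere (0 : E) 1,
      ENNReal.ofReal (|f x - f y| ^ p / ‖(x : E) - y‖ ^ q) ∂μ.toSphere ∂μ.toSphere < ⊤ := by
  obtain ⟨G, hG⟩ : ∃ G : E → E → ℝ≥0∞, ∀ X Y, G X Y = ENNReal.ofReal
      (|‖X‖ ^ a * f (‖X‖⁻¹ • X) - ‖Y‖ ^ a * f (‖Y‖⁻¹ • Y)| ^ p / ‖X - Y‖ ^ (q + 1)) :=
    ⟨_, fun _ _ => rfl⟩
  simp only [← hG] at h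
  have hGm : Measurable (Function.uncurry G) := by
    simp only [hG, Function.uncurry_def]
    fun_prop
  set c := ENNReal.ofReal (16 * (2 ^ (p - 1) * 2 ^ (q + 1) / (2 * (1 / 2) ^ |a|) ^ p)) with hc
  set I := Set.Ioo (1 / 2 : ℝ) 1 with hI
  set J := ∫⁻ x : sphere (0 : E) 1, ∫⁻ y : sphere (0 : E) 1, ∫⁻ r in I, ∫⁻ ρ in I,
    G (r • (x : E)) (ρ • (y : E)) ∂volume ∂volume ∂μ.toSphere ∂μ.toSphere with hJ
  have hJtop : J < ⊤ := (lintegral_toSphere_prod_le μ hGm).trans_lt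
    (ENNReal.mul_lt_top (by simp) (ENNReal.mul_lt_top (by simp) h))
  have hpt : ∀ x y : sphere (0 : E) 1,
      ENNReal.ofReal (|f x - f y| ^ p / ‖(x : E) - y‖ ^ q) ≤
        c * (2 * ∫⁻ r in I, ∫⁻ ρ in I, G (r • (x : E)) (ρ • (y : E))) := by
    intro x y
    have hm : Measurable fun z : ℝ × ℝ => G (z.1 • (x : E)) (z.2 • (y : E)) :=
      hGm.comp (by fun_prop : Measurable fun z : ℝ × ℝ => (z.1 • (x : E), z.2 • (y : E)))
    refine (ofReal_abs_sub_rpow_div_le_lintegral (norm_eq_of_mem_sphere x)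
      (norm_eq_of_mem_sphere y) a (fun hxy => congrArg f hxy) hp hq).trans_eq ?_
    congr 1
    calc _ = ∫⁻ r in I, ∫⁻ ρ in I,
          (G (r • (x : E)) (ρ • (y : E)) + G (ρ • (x : E)) (r • (y : E))) := by
          refine setLIntegral_congr_fun measurableSet_Ioo fun r hr =>
            setLIntegral_congr_fun measurableSet_Ioo fun ρ hρ => ?_
          have hr0 : 0 < r := by linarith [hr.1]
          have hρ0 : 0 < ρ := by linarith [hρ.1]
          simp only [hG, norm_rpow_mul_comp_normalize_smul a f (norm_eq_of_mem_sphere _) hr0,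
            norm_rpow_mul_comp_normalize_smul a f (norm_eq_of_mem_sphere _) hρ0]
      _ = ∫⁻ r in I, ((∫⁻ ρ in I, G (r • (x : E)) (ρ • (y : E))) +
          ∫⁻ ρ in I, G (ρ • (x : E)) (r • (y : E))) :=
          lintegral_congr fun r => lintegral_add_left (hm.comp measurable_prodMk_left) _
      _ = (∫⁻ r in I, ∫⁻ ρ in I, G (r • (x : E)) (ρ • (y : E))) +
          ∫⁻ r in I, ∫⁻ ρ in I, G (ρ • (x : E)) (r • (y : E)) :=
          lintegral_add_left hm.lintegral_prod_right' _
      _ = _ := by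
          rw [lintegral_lintegral_swap (f := fun r ρ => G (ρ • (x : E)) (r • (y : E)))
            (hm.comp measurable_swap).aemeasurable, two_mul]
  calc _ ≤ ∫⁻ x : sphere (0 : E) 1, ∫⁻ y : sphere (0 : E) 1,
        c * (2 * ∫⁻ r in I, ∫⁻ ρ in I, G (r • (x : E)) (ρ • (y : E)) ∂volume ∂volume)
          ∂μ.toSphere ∂μ.toSphere := lintegral_mono fun x => lintegral_mono fun y => hpt x y
    _ = c * (2 * J) := by
        have hc' : c ≠ ⊤ := ENNReal.ofReal_ne_top
        simp_rw [lintegral_const_mul' c _ hc', lintegral_const_mul' 2 _ ENNReal.ofNat_ne_top]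
        rfl
    _ < ⊤ := ENNReal.mul_lt_top ENNReal.ofReal_lt_top (ENNReal.mul_lt_top (by simp) hJtop)

end Sphere

/-- if `U_a f ∈ W^{s,p}(B)` (the `L^p` norm and Gagliardo seminorm of the
radial extension are finite), then `f ∈ W^{s,p}(∂B)`. -/
theorem trace_of_radial_extension
    (n : ℕ) (hn : 2 ≤ n) (a s p : ℝ) (hs0 : 0 < s) (hs1 : s < 1) (hp : 1 ≤ p)
    (f : EuclideanSpace ℝ (Fin n) → ℝ) (hf : Measurable f)
    (hLp : (∫⁻ X in ball (0 : EuclideanSpace ℝ (Fin n)) 1,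
        ENNReal.ofReal (|‖X‖ ^ a * f (‖X‖⁻¹ • X)| ^ p)) < ⊤)
    (hGag : (∫⁻ X in ball (0 : EuclideanSpace ℝ (Fin n)) 1,
        ∫⁻ Y in ball (0 : EuclideanSpace ℝ (Fin n)) 1,
          ENNReal.ofReal
            (|‖X‖ ^ a * f (‖X‖⁻¹ • X) - ‖Y‖ ^ a * f (‖Y‖⁻¹ • Y)| ^ p
              / ‖X - Y‖ ^ ((n : ℝ) + s * p))) < ⊤) :
    (∫⁻ x in sphere (0 : EuclideanSpace ℝ (Fin n)) 1,
        ENNReal.ofReal (|f x| ^ p) ∂μH[(n : ℝ) - 1]) < ⊤ ∧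
    (∫⁻ x in sphere (0 : EuclideanSpace ℝ (Fin n)) 1,
        ∫⁻ y in sphere (0 : EuclideanSpace ℝ (Fin n)) 1,
          ENNReal.ofReal (|f x - f y| ^ p / ‖x - y‖ ^ ((n : ℝ) - 1 + s * p))
        ∂μH[(n : ℝ) - 1] ∂μH[(n : ℝ) - 1]) < ⊤ := by
  obtain ⟨m, rfl⟩ : ∃ m, n = m + 1 := ⟨n - 1, by omega⟩
  obtain ⟨C, hC, hle⟩ := hausdorffMeasure_restrict_sphere_le_toSphere m
  have hsub : ∀ g : EuclideanSpace ℝ (Fin (m + 1)) → ℝ≥0∞,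
      ∫⁻ x in sphere (0 : EuclideanSpace ℝ (Fin (m + 1))) 1, g x ∂μH[(m : ℝ)] ≤
        C * ∫⁻ x : sphere (0 : EuclideanSpace ℝ (Fin (m + 1))) 1, g x ∂volume.toSphere := by
    intro g
    refine (lintegral_mono' hle le_rfl).trans_eq ?_
    rw [lintegral_smul_measure, smul_eq_mul,
      (MeasurableEmbedding.subtype_coe isClosed_sphere.measurableSet).lintegral_map]
  have hq : ((m + 1 : ℕ) : ℝ) + s * p = (m + s * p) + 1 := by push_cast; ring
  have hm : ((m + 1 : ℕ) : ℝ) - 1 = m := by push_cast; ring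
  have hsp : 0 ≤ s * p := by positivity
  rw [hq] at hGag
  rw [hm]
  refine ⟨(hsub _).trans_lt (ENNReal.mul_lt_top hC.lt_top
    (lintegral_toSphere_abs_rpow_lt_top volume a (by linarith) hf hLp)), ?_⟩
  refine ((lintegral_mono fun x => hsub _).trans (hsub _)).trans_lt
    (ENNReal.mul_lt_top hC.lt_top ?_)
  rw [lintegral_const_mul' _ _ hC]
  exact ENNReal.mul_lt_top hC.lt_top
    (lintegral_toSphere_gagliardo_lt_top volume a hp (by positivity) hf hGag)
end

section
/- Let $a \in \mathbb{R}$, $0 < s < 1$, $1 \le p < \infty$ and $n \ge 2$, and set $\Omega_0 := \{ X \in \mathbb{R}^n : 1/2 < |X| < 1 \}$. Let $f : \partial B \to \mathbb{R}$ be measurable and suppose that $\int_{\Omega_0} \int_{\Omega_0} \frac{|U_a f(X) - U_a f(Y)|^p}{|X-Y|^{n+sp}}\, dX\, dY > 0$ and that $\int_B \int_B \frac{|U_a f(X) - U_a f(Y)|^p}{|X-Y|^{n+sp}}\, dX\, dY < \infty$. Then $(s-a)p < n$. -/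
open MeasureTheory Metric

/-- The integrand of the Gagliardo seminorm of the radial extension `U_a f`. -/
noncomputable def radialGagliardoKernel {n : ℕ} (a s p : ℝ) (f : EuclideanSpace ℝ (Fin n) → ℝ)
    (X Y : EuclideanSpace ℝ (Fin n)) : ENNReal :=
  ENNReal.ofReal (|‖X‖ ^ a * f (‖X‖⁻¹ • X) - ‖Y‖ ^ a * f (‖Y‖⁻¹ • Y)| ^ p
    / ‖X - Y‖ ^ ((n : ℝ) + s * p))

theorem radialGagliardoKernel_smul {n : ℕ} (a s p : ℝ) (f : EuclideanSpace ℝ (Fin n) → ℝ)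
    {r : ℝ} (hr : 0 < r) (X Y : EuclideanSpace ℝ (Fin n)) :
    radialGagliardoKernel a s p f (r • X) (r • Y)
      = ENNReal.ofReal (r ^ (a * p - (n + s * p))) * radialGagliardoKernel a s p f X Y := by
  have hdir (Z : EuclideanSpace ℝ (Fin n)) : (r * ‖Z‖)⁻¹ • r • Z = ‖Z‖⁻¹ • Z := by
    rw [smul_smul, mul_inv, mul_right_comm, inv_mul_cancel₀ hr.ne', one_mul]
  unfold radialGagliardoKernel
  rw [← ENNReal.ofReal_mul (by positivity), ← smul_sub]
  simp only [norm_smul, Real.norm_of_nonneg hr.le, hdir]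
  rw [Real.mul_rpow hr.le (norm_nonneg X), Real.mul_rpow hr.le (norm_nonneg Y),
    Real.mul_rpow hr.le (norm_nonneg _), mul_assoc, mul_assoc, ← mul_sub, abs_mul,
    abs_of_pos (Real.rpow_pos_of_pos hr a), Real.mul_rpow (by positivity) (abs_nonneg _),
    ← Real.rpow_mul hr.le, Real.rpow_sub hr, mul_div_mul_comm]

/-- Dilation by `r` scales Lebesgue integrals over sets by `r ^ n`, without measurability. -/
theorem setLIntegral_eq_setLIntegral_preimage_smul {n : ℕ} {r : ℝ} (hr : 0 < r)
    (g : EuclideanSpace ℝ (Fin n) → ENNReal) (S : Set (EuclideanSpace ℝ (Fin n))) :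
    ∫⁻ X in S, g X
      = ENNReal.ofReal (r ^ n) * ∫⁻ X in (fun X => r • X) ⁻¹' S, g (r • X) := by
  have he : MeasurableEmbedding (fun X : EuclideanSpace ℝ (Fin n) => r • X) :=
    (Homeomorph.smulOfNeZero r hr.ne').measurableEmbedding
  have hmap := Measure.map_addHaar_smul (volume : Measure (EuclideanSpace ℝ (Fin n))) hr.ne'
  rw [finrank_euclideanSpace_fin, abs_of_pos (by positivity)] at hmap
  have hint : ∫⁻ X in (fun X => r • X) ⁻¹' S, g (r • X)
      = ENNReal.ofReal (r ^ n)⁻¹ * ∫⁻ X in S, g X := by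
    rw [← he.lintegral_map, ← he.restrict_map]
    change ∫⁻ X, g X ∂((Measure.map (r • ·) volume).restrict S) = _
    rw [hmap, Measure.restrict_smul, lintegral_smul_measure, smul_eq_mul]
  rw [hint, ← mul_assoc, ← ENNReal.ofReal_mul (by positivity), mul_inv_cancel₀ (by positivity),
    ENNReal.ofReal_one, one_mul]

theorem lintegral_radialGagliardoKernel_preimage_smul {n : ℕ} (a s p : ℝ)
    (f : EuclideanSpace ℝ (Fin n) → ℝ) {r : ℝ} (hr : 0 < r) (S : Set (EuclideanSpace ℝ (Fin n))) :
    ∫⁻ X in S, ∫⁻ Y in S, radialGagliardoKernel a s p f X Y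
      = ENNReal.ofReal (r ^ (n - (s - a) * p)) *
        ∫⁻ X in (fun X => r • X) ⁻¹' S, ∫⁻ Y in (fun X => r • X) ⁻¹' S,
          radialGagliardoKernel a s p f X Y := by
  rw [setLIntegral_eq_setLIntegral_preimage_smul hr]
  simp_rw [setLIntegral_eq_setLIntegral_preimage_smul hr _ S, radialGagliardoKernel_smul a s p f hr]
  simp_rw [lintegral_const_mul' _ _ ENNReal.ofReal_ne_top]
  rw [← mul_assoc, ← mul_assoc, ← ENNReal.ofReal_mul (by positivity),
    ← ENNReal.ofReal_mul (by positivity), ← Real.rpow_natCast, ← Real.rpow_add hr,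
    ← Real.rpow_add hr]
  ring_nf

/-- Finiteness on a set containing infinitely many disjoint dilates of `S` by factors at most one
forces the seminorm on `S` to decay under dilation. -/
theorem sub_mul_lt_of_lintegral_radialGagliardoKernel {n : ℕ} {a s p : ℝ}
    {f : EuclideanSpace ℝ (Fin n) → ℝ} {S T : Set (EuclideanSpace ℝ (Fin n))}
    (hS : MeasurableSet S) {r : ℕ → ℝ} (hr0 : ∀ j, 0 < r j) (hr1 : ∀ j, r j ≤ 1)
    (hdisj : Pairwise (Function.onFun Disjoint fun j => (fun X => (r j)⁻¹ • X) ⁻¹' S))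
    (hT : ∀ j, (fun X => (r j)⁻¹ • X) ⁻¹' S ⊆ T)
    (hpos : 0 < ∫⁻ X in S, ∫⁻ Y in S, radialGagliardoKernel a s p f X Y)
    (hfin : ∫⁻ X in T, ∫⁻ Y in T, radialGagliardoKernel a s p f X Y < ⊤) :
    (s - a) * p < n := by
  by_contra! hle
  set A : ℕ → Set (EuclideanSpace ℝ (Fin n)) := fun j => (fun X => (r j)⁻¹ • X) ⁻¹' S with hA
  have hpre (j : ℕ) : (fun X => r j • X) ⁻¹' A j = S := by
    ext X
    simp [hA, smul_smul, inv_mul_cancel₀ (hr0 j).ne']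
  have hge (j : ℕ) : ∫⁻ X in S, ∫⁻ Y in S, radialGagliardoKernel a s p f X Y
      ≤ ∫⁻ X in A j, ∫⁻ Y in T, radialGagliardoKernel a s p f X Y :=
    calc
      _ ≤ ENNReal.ofReal (r j ^ (n - (s - a) * p)) *
          ∫⁻ X in S, ∫⁻ Y in S, radialGagliardoKernel a s p f X Y := by
        refine le_mul_of_one_le_left' ?_
        rw [ENNReal.one_le_ofReal]
        exact Real.one_le_rpow_of_pos_of_le_one_of_nonpos (hr0 j) (hr1 j) (by linarith)
      _ = ∫⁻ X in A j, ∫⁻ Y in A j, radialGagliardoKernel a s p f X Y := by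
        rw [lintegral_radialGagliardoKernel_preimage_smul a s p f (hr0 j) (A j), hpre]
      _ ≤ _ := lintegral_mono fun X => lintegral_mono_set (hT j)
  refine hfin.ne (top_unique ?_)
  calc
    ⊤ = ∑' _ : ℕ, ∫⁻ X in S, ∫⁻ Y in S, radialGagliardoKernel a s p f X Y :=
      (ENNReal.tsum_const_eq_top_of_ne_zero hpos.ne').symm
    _ ≤ ∑' j, ∫⁻ X in A j, ∫⁻ Y in T, radialGagliardoKernel a s p f X Y := ENNReal.tsum_le_tsum hge
    _ = ∫⁻ X in ⋃ j, A j, ∫⁻ Y in T, radialGagliardoKernel a s p f X Y :=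
      (lintegral_iUnion (fun j => hS.preimage (measurable_const_smul _)) hdisj _).symm
    _ ≤ _ := lintegral_mono_set (Set.iUnion_subset hT)

/-- if the Gagliardo seminorm of `U_a f` on the annulus
`Ω₀ = {1/2 < |X| < 1}` is positive while the full seminorm over the ball is finite,
then necessarily `(s-a)p < n`. -/
theorem necessity_of_exponent_condition
    (n : ℕ) (hn : 2 ≤ n) (a s p : ℝ) (hs0 : 0 < s) (hs1 : s < 1) (hp : 1 ≤ p)
    (f : EuclideanSpace ℝ (Fin n) → ℝ) (hf : Measurable f)
    (hpos : 0 < ∫⁻ X in {X : EuclideanSpace ℝ (Fin n) | (1 / 2 : ℝ) < ‖X‖ ∧ ‖X‖ < 1},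
        ∫⁻ Y in {Y : EuclideanSpace ℝ (Fin n) | (1 / 2 : ℝ) < ‖Y‖ ∧ ‖Y‖ < 1},
          ENNReal.ofReal
            (|‖X‖ ^ a * f (‖X‖⁻¹ • X) - ‖Y‖ ^ a * f (‖Y‖⁻¹ • Y)| ^ p
              / ‖X - Y‖ ^ ((n : ℝ) + s * p)))
    (hfin : (∫⁻ X in ball (0 : EuclideanSpace ℝ (Fin n)) 1,
        ∫⁻ Y in ball (0 : EuclideanSpace ℝ (Fin n)) 1,
          ENNReal.ofReal
            (|‖X‖ ^ a * f (‖X‖⁻¹ • X) - ‖Y‖ ^ a * f (‖Y‖⁻¹ • Y)| ^ p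
              / ‖X - Y‖ ^ ((n : ℝ) + s * p))) < ⊤) :
    (s - a) * p < n := by
  have hmem (j : ℕ) (X : EuclideanSpace ℝ (Fin n)) :
      X ∈ (fun X => (((1 / 2 : ℝ) ^ j)⁻¹) • X) ⁻¹'
        {X : EuclideanSpace ℝ (Fin n) | (1 / 2 : ℝ) < ‖X‖ ∧ ‖X‖ < 1} ↔
      (1 / 2 : ℝ) ^ (j + 1) < ‖X‖ ∧ ‖X‖ < (1 / 2 : ℝ) ^ j := by
    have h : (0 : ℝ) < (1 / 2) ^ j := by positivity
    rw [Set.mem_preimage, Set.mem_ofPred_eq, norm_smul, Real.norm_of_nonneg (by positivity),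
      lt_inv_mul_iff₀ h, inv_mul_lt_iff₀ h, mul_one, pow_succ]
  refine sub_mul_lt_of_lintegral_radialGagliardoKernel (r := fun j => (1 / 2 : ℝ) ^ j) ?_
    (fun j => by positivity) (fun j => pow_le_one₀ (by norm_num) (by norm_num)) ?_ ?_ hpos hfin
  · exact (measurableSet_lt measurable_const measurable_norm).inter
      (measurableSet_lt measurable_norm measurable_const)
  · refine (pairwise_disjoint_on _).2 fun i j hij => Set.disjoint_left.2 fun X hi hj => ?_
    have hlt := ((hmem i X).1 hi).1.trans ((hmem j X).1 hj).2
    exact hlt.not_ge (pow_le_pow_of_le_one (by norm_num) (by norm_num) hij)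
  · intro j X hX
    exact mem_ball_zero_iff.2
      (((hmem j X).1 hX).2.trans_le (pow_le_one₀ (by norm_num) (by norm_num)))
end
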